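/- For every density matrix d₀ ∈ M₄(ℂ) there exists a unique differentiable map d : ℝ → M₄(ℂ) with d(0) = d₀ satisfying the self-consistent von Neumann equation d′(t) = −i·[dh(Tr(d(t)·A↓A↑)), d(t)] for all t ∈ ℝ; moreover this solution d(t) is a density matrix for every t ∈ ℝ. (This is the finite-dimensional self-consistency equation: there is a unique family (ϖ(t;ρ₀)) of on-site states with ϖ(t;ρ₀) = ρ₀ ∘ τ_{t,0}^{ϖ(·;ρ₀)}.) -/

import Mathlib

open Matrix
open scoped ComplexOrder

noncomputable section

/-- `M₄(ℂ)`, the algebra of 4×4 complex matrices, identified with the linear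
operators on the one-site fermionic Fock space `ℂ⁴`. -/
abbrev M4 : Type := Matrix (Fin 4) (Fin 4) ℂ

noncomputable instance : NormedAddCommGroup M4 := Matrix.normedAddCommGroup
noncomputable instance : NormedSpace ℝ M4 := Matrix.normedSpace

/-- The canonical anticommutation relations for the two matrices `A↑ = Aup`,
`A↓ = Adn`: `Aₛ·Aₜ + Aₜ·Aₛ = 0` and `Aₛ·Aₜ* + Aₜ*·Aₛ = δ_{s,t}·1` for
`s, t ∈ {↑,↓}`. -/
def CAR (Aup Adn : M4) : Prop :=
  Aup * Aup + Aup * Aup = 0 ∧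
  Aup * Adn + Adn * Aup = 0 ∧
  Adn * Adn + Adn * Adn = 0 ∧
  Aup * Aupᴴ + Aupᴴ * Aup = 1 ∧
  Aup * Adnᴴ + Adnᴴ * Aup = 0 ∧
  Adn * Aupᴴ + Aupᴴ * Adn = 0 ∧
  Adn * Adnᴴ + Adnᴴ * Adn = 1

/-- `dh(c) := 2λ n↑n↓ − μ(n↑+n↓) − h(n↑−n↓) − γ(c·A↑*A↓* + c̄·A↓A↑)`,
where `nₛ := Aₛ*·Aₛ`. -/
def dh (Aup Adn : M4) (mu h lam gam : ℝ) (c : ℂ) : M4 :=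
  (2 * lam : ℂ) • (Aupᴴ * Aup * (Adnᴴ * Adn))
    - (mu : ℂ) • (Aupᴴ * Aup + Adnᴴ * Adn)
    - (h : ℂ) • (Aupᴴ * Aup - Adnᴴ * Adn)
    - (gam : ℂ) • (c • (Aupᴴ * Adnᴴ) + (starRingEnd ℂ c) • (Adn * Aup))

/-- A density matrix: Hermitian, positive semidefinite, of trace 1. -/
def IsDensityMatrix (d : M4) : Prop :=
  d.IsHermitian ∧ d.PosSemidef ∧ d.trace = 1

/-- A self-consistent trajectory: a differentiable map `d : ℝ → M₄(ℂ)` such that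
`d t` is a density matrix for all `t` and
`d′(t) = −i·[dh(Tr(d(t)·A↓A↑)), d(t)]` for all `t ∈ ℝ`. -/
def SelfConsistent (Aup Adn : M4) (mu h lam gam : ℝ) (d : ℝ → M4) : Prop :=
  (∀ t : ℝ, IsDensityMatrix (d t)) ∧
  ∀ t : ℝ, HasDerivAt d
      ((-Complex.I) •
        (dh Aup Adn mu h lam gam ((d t * (Adn * Aup)).trace) * d t
          - d t * dh Aup Adn mu h lam gam ((d t * (Adn * Aup)).trace))) t

open Manifold in
/-- Two global integral curves of a `C¹` vector field that meet at one time coincide. -/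
theorem ContDiff.integralCurve_unique {E : Type*} [NormedAddCommGroup E] [NormedSpace ℝ E]
    [CompleteSpace E] {v : E → E} (hv : ContDiff ℝ 1 v) {γ γ' : ℝ → E}
    (hγ : ∀ t, HasDerivAt γ (v (γ t)) t) (hγ' : ∀ t, HasDerivAt γ' (v (γ' t)) t)
    {t₀ : ℝ} (h : γ t₀ = γ' t₀) : γ = γ' :=
  isMIntegralCurve_Ioo_eq_of_contMDiff_boundaryless (I := 𝓘(ℝ, E)) (v := v)
    (contMDiff_vectorSpace_iff_contDiff.2 hv)
    (fun t => (hγ t).hasFDerivAt.hasMFDerivAt) (fun t => (hγ' t).hasFDerivAt.hasMFDerivAt) h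

open Set Manifold in
/-- A compactly supported `C¹` vector field is complete. -/
theorem ContDiff.exists_integralCurve_of_hasCompactSupport {E : Type*} [NormedAddCommGroup E]
    [NormedSpace ℝ E] [CompleteSpace E] {v : E → E} (hv : ContDiff ℝ 1 v)
    (hc : HasCompactSupport v) (x : E) :
    ∃ γ : ℝ → E, γ 0 = x ∧ ∀ t, HasDerivAt γ (v (γ t)) t := by
  obtain ⟨K, hK⟩ := hv.lipschitzWith_of_hasCompactSupport hc one_ne_zero
  obtain ⟨C, hC⟩ := hc.exists_bound_of_continuous hv.continuous
  obtain ⟨γ, h0, hγ⟩ := exists_isMIntegralCurve_of_isMIntegralCurveOn (I := 𝓘(ℝ, E)) (v := v)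
    (contMDiff_vectorSpace_iff_contDiff.2 hv) one_pos (fun y => by
      have hp : IsPicardLindelof (fun _ : ℝ => v) (tmin := -1) (tmax := 1) ⟨0, by simp⟩ y
          C.toNNReal 0 C.toNNReal K :=
        .of_time_independent (fun z _ => (hC z).trans (Real.le_coe_toNNReal C))
          hK.lipschitzOnWith (by simp)
      obtain ⟨γ, h0, hγ⟩ := hp.exists_eq_forall_mem_Icc_hasDerivWithinAt₀
      exact ⟨γ, h0, fun t ht => ((hγ t (Ioo_subset_Icc_self ht)).hasDerivAt
        (Icc_mem_nhds ht.1 ht.2)).hasFDerivAt.hasMFDerivAt.hasMFDerivWithinAt⟩) x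
  exact ⟨γ, h0, fun t => by
    have h : HasFDerivAt γ ((1 : ℝ →L[ℝ] ℝ).smulRight (v (γ t))) t :=
      hasMFDerivAt_iff_hasFDerivAt.1 (hγ t)
    simpa using h.hasDerivAt⟩

namespace M4

lemma contDiff_iff {E : Type*} [NormedAddCommGroup E] [NormedSpace ℝ E] {f : E → M4} :
    ContDiff ℝ 1 f ↔ ∀ i j, ContDiff ℝ 1 fun x => f x i j :=
  contDiff_pi.trans (forall_congr' fun _ => contDiff_pi)

lemma hasDerivAt_iff {f : ℝ → M4} {f' : M4} {t : ℝ} :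
    HasDerivAt f f' t ↔ ∀ i j, HasDerivAt (fun s => f s i j) (f' i j) t :=
  hasDerivAt_pi.trans (forall_congr' fun _ => hasDerivAt_pi)

lemma contDiff_mul {E : Type*} [NormedAddCommGroup E] [NormedSpace ℝ E] {f g : E → M4}
    (hf : ContDiff ℝ 1 f) (hg : ContDiff ℝ 1 g) : ContDiff ℝ 1 fun x => f x * g x := by
  rw [contDiff_iff] at *
  intro i j
  simp only [Matrix.mul_apply]
  exact ContDiff.sum fun k _ => (hf i k).mul (hg k j)

lemma contDiff_conjTranspose {E : Type*} [NormedAddCommGroup E] [NormedSpace ℝ E] {f : E → M4}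
    (hf : ContDiff ℝ 1 f) : ContDiff ℝ 1 fun x => (f x)ᴴ := by
  rw [contDiff_iff] at *
  exact fun i j => Complex.conjCLE.contDiff.comp (hf j i)

lemma contDiff_trace {E : Type*} [NormedAddCommGroup E] [NormedSpace ℝ E] {f : E → M4}
    (hf : ContDiff ℝ 1 f) : ContDiff ℝ 1 fun x => (f x).trace := by
  rw [contDiff_iff] at hf
  exact ContDiff.sum fun k _ => hf k k

lemma contDiff_smul {E : Type*} [NormedAddCommGroup E] [NormedSpace ℝ E] {c : E → ℂ} {f : E → M4}
    (hc : ContDiff ℝ 1 c) (hf : ContDiff ℝ 1 f) : ContDiff ℝ 1 fun x => c x • f x := by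
  rw [contDiff_iff] at *
  exact fun i j => hc.mul (hf i j)

lemma hasDerivAt_mul {f g : ℝ → M4} {f' g' : M4} {t : ℝ} (hf : HasDerivAt f f' t)
    (hg : HasDerivAt g g' t) : HasDerivAt (fun s => f s * g s) (f' * g t + f t * g') t := by
  rw [hasDerivAt_iff] at *
  intro i j
  simp only [Matrix.mul_apply, Matrix.add_apply, ← Finset.sum_add_distrib]
  exact HasDerivAt.fun_sum fun k _ => (hf i k).mul (hg k j)

lemma hasDerivAt_conjTranspose {f : ℝ → M4} {f' : M4} {t : ℝ} (hf : HasDerivAt f f' t) :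
    HasDerivAt (fun s => (f s)ᴴ) f'ᴴ t := by
  rw [hasDerivAt_iff] at *
  exact fun i j => (hf j i).star

lemma norm_le_one_of_conjTranspose_mul_self {U : M4} (hU : Uᴴ * U = 1) : ‖U‖ ≤ 1 :=
  entrywise_sup_norm_bound_of_unitary (mem_unitaryGroup_iff'.2 hU)

/-- A curve driven by a skew-adjoint generator, starting at the identity, stays unitary. -/
lemma conjTranspose_mul_self_eq_one {U G : ℝ → M4} (hG : ∀ t, (G t)ᴴ = -G t) (h0 : U 0 = 1)
    (hU : ∀ t, HasDerivAt U (G t * U t) t) (t : ℝ) : (U t)ᴴ * U t = 1 := by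
  have hd : ∀ s, HasDerivAt (fun s => (U s)ᴴ * U s) 0 s := fun s => by
    convert hasDerivAt_mul (hasDerivAt_conjTranspose (hU s)) (hU s) using 1
    simp [hG, Matrix.mul_assoc]
  have := is_const_of_deriv_eq_zero (fun s => (hd s).differentiableAt) (fun s => (hd s).deriv) t 0
  simpa [h0] using this

/-- Global unitary solutions of `U' = -i H(U) U` for a Hermitian-valued `C¹` map `H`. -/
theorem exists_unitary_flow {H : M4 → M4} (hH : ContDiff ℝ 1 H) (hHerm : ∀ U, (H U).IsHermitian) :
    ∃ U : ℝ → M4, U 0 = 1 ∧ ∀ t, (U t)ᴴ * U t = 1 ∧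
      HasDerivAt U (-Complex.I • (H (U t) * U t)) t := by
  let χ : ContDiffBump (0 : M4) := ⟨1, 2, one_pos, one_lt_two⟩
  let G : M4 → M4 := fun U => (χ U : ℂ) • (-Complex.I • H U)
  have hG : ∀ U, (G U)ᴴ = -G U := fun U => by
    simp [G, (hHerm U).eq]
  have hGsmooth : ContDiff ℝ 1 fun U => G U * U :=
    contDiff_mul (contDiff_smul (Complex.ofRealCLM.contDiff.comp χ.contDiff)
      (contDiff_smul contDiff_const hH)) contDiff_id
  have hGsupp : HasCompactSupport fun U => G U * U :=
    χ.hasCompactSupport.mono fun U hU h => hU (by simp [G, show χ U = 0 from h])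
  obtain ⟨U, h0, hU⟩ := hGsmooth.exists_integralCurve_of_hasCompactSupport hGsupp 1
  have hunit := conjTranspose_mul_self_eq_one (fun t => hG (U t)) h0 hU
  refine ⟨U, h0, fun t => ⟨hunit t, ?_⟩⟩
  have hχ : χ (U t) = 1 := χ.one_of_mem_closedBall
    (mem_closedBall_zero_iff.2 (norm_le_one_of_conjTranspose_mul_self (hunit t)))
  exact (hU t).congr_deriv (by simp [G, hχ])

end M4

lemma IsDensityMatrix.unitary_conj {d U : M4} (hd : IsDensityMatrix d) (hU : Uᴴ * U = 1) :
    IsDensityMatrix (U * d * Uᴴ) := by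
  have hp := hd.2.1.mul_mul_conjTranspose_same U
  refine ⟨hp.isHermitian, hp, ?_⟩
  rw [Matrix.trace_mul_comm, ← Matrix.mul_assoc, hU, Matrix.one_mul, hd.2.2]

lemma dh_isHermitian {Aup Adn : M4} (hCAR : CAR Aup Adn) (mu h lam gam : ℝ) (c : ℂ) :
    (dh Aup Adn mu h lam gam c).IsHermitian := by
  obtain ⟨-, h1, -, -, h2, h3, -⟩ := hCAR
  have e1 : Adn * Aup = -(Aup * Adn) := (neg_eq_of_add_eq_zero_right h1).symm
  have e2 : Adn * Aupᴴ = -(Aupᴴ * Adn) := eq_neg_of_add_eq_zero_left h3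
  have e3 : Aup * Adnᴴ = -(Adnᴴ * Aup) := eq_neg_of_add_eq_zero_left h2
  have e4 : Adnᴴ * Aupᴴ = -(Aupᴴ * Adnᴴ) := by
    simpa using congrArg conjTranspose (eq_neg_of_add_eq_zero_left h1)
  have hn : Adnᴴ * Adn * (Aupᴴ * Aup) = Aupᴴ * Aup * (Adnᴴ * Adn) := by
    calc Adnᴴ * Adn * (Aupᴴ * Aup) = Adnᴴ * (Adn * Aupᴴ) * Aup := by noncomm_ring
      _ = -(Adnᴴ * Aupᴴ * (Adn * Aup)) := by rw [e2]; noncomm_ring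
      _ = -(Aupᴴ * (Adnᴴ * Aup) * Adn) := by rw [e4, e1]; noncomm_ring
      _ = Aupᴴ * Aup * (Adnᴴ * Adn) := by
        rw [← neg_eq_iff_eq_neg.2 e3]; noncomm_ring
  simp [Matrix.IsHermitian, dh, hn, add_comm]

lemma contDiff_dh (Aup Adn : M4) (mu h lam gam : ℝ) :
    ContDiff ℝ 1 (dh Aup Adn mu h lam gam) :=
  contDiff_const.sub (M4.contDiff_smul contDiff_const
    ((M4.contDiff_smul contDiff_id contDiff_const).add
      (M4.contDiff_smul Complex.conjCLE.contDiff contDiff_const)))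

/-- for every density matrix `d₀` there is a unique differentiable
map `d : ℝ → M₄(ℂ)` with `d 0 = d₀` solving the self-consistent von Neumann
equation `d′(t) = −i·[dh(Tr(d(t)·A↓A↑)), d(t)]`; moreover any such solution is a
density matrix at every time. -/
theorem selfConsistency_existence_uniqueness (Aup Adn : M4) (hCAR : CAR Aup Adn)
    (mu h lam gam : ℝ) (hgam : 0 ≤ gam)
    (d₀ : M4) (hd₀ : IsDensityMatrix d₀) :
    (∃! d : ℝ → M4,
        d 0 = d₀ ∧
        ∀ t : ℝ, HasDerivAt d
          ((-Complex.I) •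
            (dh Aup Adn mu h lam gam ((d t * (Adn * Aup)).trace) * d t
              - d t * dh Aup Adn mu h lam gam ((d t * (Adn * Aup)).trace))) t) ∧
    (∀ d : ℝ → M4,
        d 0 = d₀ →
        (∀ t : ℝ, HasDerivAt d
          ((-Complex.I) •
            (dh Aup Adn mu h lam gam ((d t * (Adn * Aup)).trace) * d t
              - d t * dh Aup Adn mu h lam gam ((d t * (Adn * Aup)).trace))) t) →
        ∀ t : ℝ, IsDensityMatrix (d t)) := by
  have hcomp : ∀ {f : M4 → M4}, ContDiff ℝ 1 f →
      ContDiff ℝ 1 fun x => dh Aup Adn mu h lam gam ((f x * (Adn * Aup)).trace) := fun hf =>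
    (contDiff_dh Aup Adn mu h lam gam).comp
      (M4.contDiff_trace (M4.contDiff_mul hf contDiff_const))
  have hfield : ContDiff ℝ 1 fun x : M4 => (-Complex.I) •
      (dh Aup Adn mu h lam gam ((x * (Adn * Aup)).trace) * x
        - x * dh Aup Adn mu h lam gam ((x * (Adn * Aup)).trace)) :=
    M4.contDiff_smul contDiff_const ((M4.contDiff_mul (hcomp contDiff_id) contDiff_id).sub
      (M4.contDiff_mul contDiff_id (hcomp contDiff_id)))
  obtain ⟨U, hU0, hU⟩ := M4.exists_unitary_flow
    (H := fun U => dh Aup Adn mu h lam gam ((U * d₀ * Uᴴ * (Adn * Aup)).trace))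
    (hcomp (M4.contDiff_mul (M4.contDiff_mul contDiff_id contDiff_const)
      (M4.contDiff_conjTranspose contDiff_id)))
    (fun _ => dh_isHermitian hCAR mu h lam gam _)
  have hd : ∀ t, HasDerivAt (fun s => U s * d₀ * (U s)ᴴ) ((-Complex.I) •
      (dh Aup Adn mu h lam gam ((U t * d₀ * (U t)ᴴ * (Adn * Aup)).trace) * (U t * d₀ * (U t)ᴴ)
        - U t * d₀ * (U t)ᴴ *
          dh Aup Adn mu h lam gam ((U t * d₀ * (U t)ᴴ * (Adn * Aup)).trace))) t := fun t => by
    convert M4.hasDerivAt_mul (M4.hasDerivAt_mul (hU t).2 (hasDerivAt_const t d₀))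
      (M4.hasDerivAt_conjTranspose (hU t).2) using 1
    have hH := dh_isHermitian hCAR mu h lam gam ((U t * d₀ * (U t)ᴴ * (Adn * Aup)).trace)
    generalize dh Aup Adn mu h lam gam ((U t * d₀ * (U t)ᴴ * (Adn * Aup)).trace) = H at hH
    simp [hH.eq, Matrix.mul_assoc, sub_eq_add_neg]
  have huniq : ∀ d : ℝ → M4, d 0 = d₀ → (∀ t : ℝ, HasDerivAt d ((-Complex.I) •
      (dh Aup Adn mu h lam gam ((d t * (Adn * Aup)).trace) * d t
        - d t * dh Aup Adn mu h lam gam ((d t * (Adn * Aup)).trace))) t) →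
      d = fun s => U s * d₀ * (U s)ᴴ := fun d h0 hd' =>
    hfield.integralCurve_unique hd' hd (t₀ := 0) (by simp [h0, hU0])
  refine ⟨⟨_, ⟨by simp [hU0], hd⟩, fun d hd' => huniq d hd'.1 hd'.2⟩, fun d h0 hd' t => ?_⟩
  rw [huniq d h0 hd']
  exact hd₀.unitary_conj (hU t).1
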